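/- arXiv:1603.04482 — 3 statements merged into one kernel-verified Lean document; each statement's English description precedes it below -/
import Mathlib

section
/- The bias fixed point is unique: if b¹, b² : U → ℝ satisfy T(b¹) = b¹ and T(b²) = b², then b¹ = b². -/
open Finset

noncomputable def clamp (x : ℝ) : ℝ := max 0 (min 1 x)

/-- The set of users rating object `j`. -/
def dminus {U O : Type} [Fintype U] [DecidableEq O] (dplus : U → Finset O) (j : O) :
    Finset U :=
  Finset.univ.filter (fun i => j ∈ dplus i)

/-- The true-rating map `R(b)`. -/
noncomputable def Rmap {U O : Type} [Fintype U] [DecidableEq O] (dplus : U → Finset O)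
    (w : U → O → ℝ) (α : ℝ) (b : U → ℝ) (j : O) : ℝ :=
  (∑ i ∈ dminus dplus j, clamp (w i j - α * b i)) / (dminus dplus j).card

/-- The bias-update map `T(b)`. -/
noncomputable def Tmap {U O : Type} [Fintype U] [DecidableEq O] (dplus : U → Finset O)
    (w : U → O → ℝ) (α : ℝ) (b : U → ℝ) (i : U) : ℝ :=
  (∑ j ∈ dplus i, (w i j - Rmap dplus w α b j)) / (dplus i).card

theorem abs_clamp_sub_clamp_le (x y : ℝ) : |clamp x - clamp y| ≤ |x - y| := by
  unfold clamp
  calc |max 0 (min 1 x) - max 0 (min 1 y)|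
      ≤ max |(0 : ℝ) - 0| |min 1 x - min 1 y| := abs_max_sub_max_le_max _ _ _ _
    _ ≤ |min 1 x - min 1 y| := by simp
    _ ≤ max |(1 : ℝ) - 1| |x - y| := abs_min_sub_min_le_max _ _ _ _
    _ ≤ |x - y| := by simp

theorem abs_average_sub_average_le {ι : Type*} {s : Finset ι} (hs : s.Nonempty)
    {f g : ι → ℝ} {c : ℝ} (h : ∀ i ∈ s, |f i - g i| ≤ c) :
    |(∑ i ∈ s, f i) / s.card - (∑ i ∈ s, g i) / s.card| ≤ c := by
  have hcard : (0 : ℝ) < s.card := by exact_mod_cast hs.card_pos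
  rw [← sub_div, ← Finset.sum_sub_distrib, abs_div, abs_of_pos hcard, div_le_iff₀ hcard]
  calc |∑ i ∈ s, (f i - g i)| ≤ ∑ i ∈ s, |f i - g i| := Finset.abs_sum_le_sum_abs _ _
    _ ≤ s.card • c := Finset.sum_le_card_nsmul _ _ _ h
    _ = c * s.card := by rw [nsmul_eq_mul, mul_comm]

theorem fixed_point_unique
    {U O : Type} [Fintype U] [Nonempty U] [Fintype O] [Nonempty O] [DecidableEq O]
    (dplus : U → Finset O) (hd : ∀ i : U, (dplus i).Nonempty)
    (hdm : ∀ j : O, (dminus dplus j).Nonempty)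
    (w : U → O → ℝ) (hw : ∀ i j, w i j ∈ Set.Icc (0 : ℝ) 1)
    (α : ℝ) (hα0 : 0 < α) (hα1 : α < 1)
    (b₁ b₂ : U → ℝ) (h₁ : Tmap dplus w α b₁ = b₁) (h₂ : Tmap dplus w α b₂ = b₂) :
    b₁ = b₂ := by
  obtain ⟨k, hk⟩ := Finite.exists_max fun i => |b₁ i - b₂ i|
  have hR (j : O) : |Rmap dplus w α b₁ j - Rmap dplus w α b₂ j| ≤ α * |b₁ k - b₂ k| := by
    refine abs_average_sub_average_le (hdm j) fun i _ => ?_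
    calc |clamp (w i j - α * b₁ i) - clamp (w i j - α * b₂ i)|
        ≤ |(w i j - α * b₁ i) - (w i j - α * b₂ i)| := abs_clamp_sub_clamp_le _ _
      _ = α * |b₁ i - b₂ i| := by
        rw [sub_sub_sub_cancel_left, ← mul_sub, abs_mul, abs_of_pos hα0, abs_sub_comm]
      _ ≤ α * |b₁ k - b₂ k| := mul_le_mul_of_nonneg_left (hk i) hα0.le
  have hT : |Tmap dplus w α b₁ k - Tmap dplus w α b₂ k| ≤ α * |b₁ k - b₂ k| := by
    refine abs_average_sub_average_le (hd k) fun j _ => ?_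
    rw [sub_sub_sub_cancel_left, abs_sub_comm]
    exact hR j
  rw [h₁, h₂] at hT
  have hmax : |b₁ k - b₂ k| ≤ 0 := by nlinarith
  funext i
  exact sub_eq_zero.mp (abs_nonpos_iff.mp ((hk i).trans hmax))
end

section
/- If the initial bias satisfies b⁰(i) ∈ [−1,1] for all i, and b* : U → ℝ is the fixed point of T (T(b*) = b*), then for every iteration t ≥ 0 and every user i : U, |b^{t}(i) − b*(i)| ≤ 2·α^{t}. -/
open Finset

/-- An average of terms in `[-c, c]` lies in `[-c, c]`. -/
theorem abs_sum_div_card_le {ι : Type*} {s : Finset ι} (hs : s.Nonempty) {f : ι → ℝ} {c : ℝ}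
    (hf : ∀ i ∈ s, |f i| ≤ c) : |(∑ i ∈ s, f i) / s.card| ≤ c := by
  have hpos : (0 : ℝ) < s.card := by exact_mod_cast hs.card_pos
  rw [abs_div, abs_of_pos hpos, div_le_iff₀ hpos, mul_comm, ← nsmul_eq_mul]
  exact (abs_sum_le_sum_abs f s).trans (sum_le_card_nsmul s _ c hf)

theorem clamp_mem_Icc (x : ℝ) : clamp x ∈ Set.Icc (0 : ℝ) 1 :=
  ⟨le_max_left _ _, max_le zero_le_one (min_le_left _ _)⟩

section

variable {U O : Type} [Fintype U] [DecidableEq O] {dplus : U → Finset O}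

theorem Rmap_mem_Icc (hdm : ∀ j : O, (dminus dplus j).Nonempty) (w : U → O → ℝ) (α : ℝ)
    (b : U → ℝ) (j : O) : Rmap dplus w α b j ∈ Set.Icc (0 : ℝ) 1 := by
  refine ⟨div_nonneg (sum_nonneg fun i _ => (clamp_mem_Icc _).1) (Nat.cast_nonneg _), ?_⟩
  refine (le_abs_self _).trans (abs_sum_div_card_le (hdm j) fun i _ => ?_)
  rw [abs_of_nonneg (clamp_mem_Icc _).1]
  exact (clamp_mem_Icc _).2

theorem abs_Tmap_le_one (hd : ∀ i : U, (dplus i).Nonempty)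
    (hdm : ∀ j : O, (dminus dplus j).Nonempty) {w : U → O → ℝ}
    (hw : ∀ i j, w i j ∈ Set.Icc (0 : ℝ) 1) (α : ℝ) (b : U → ℝ) (i : U) :
    |Tmap dplus w α b i| ≤ 1 := by
  refine abs_sum_div_card_le (hd i) fun j _ => ?_
  have hR := Rmap_mem_Icc hdm w α b j
  have hwij := hw i j
  exact abs_le.2 ⟨by linarith [hwij.1, hR.2], by linarith [hwij.2, hR.1]⟩

theorem abs_Rmap_sub_Rmap_le (hdm : ∀ j : O, (dminus dplus j).Nonempty) (w : U → O → ℝ)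
    {α : ℝ} (hα : 0 ≤ α) {b b' : U → ℝ} {c : ℝ} (h : ∀ i, |b i - b' i| ≤ c) (j : O) :
    |Rmap dplus w α b j - Rmap dplus w α b' j| ≤ α * c := by
  unfold Rmap
  rw [← sub_div, ← sum_sub_distrib]
  refine abs_sum_div_card_le (hdm j) fun i _ => (abs_clamp_sub_clamp_le _ _).trans ?_
  rw [sub_sub_sub_cancel_left, ← mul_sub, abs_mul, abs_of_nonneg hα, abs_sub_comm]
  exact mul_le_mul_of_nonneg_left (h i) hα

/-- `Tmap` contracts the sup distance by a factor `α`. -/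
theorem abs_Tmap_sub_Tmap_le (hd : ∀ i : U, (dplus i).Nonempty)
    (hdm : ∀ j : O, (dminus dplus j).Nonempty) (w : U → O → ℝ)
    {α : ℝ} (hα : 0 ≤ α) {b b' : U → ℝ} {c : ℝ} (h : ∀ i, |b i - b' i| ≤ c) (i : U) :
    |Tmap dplus w α b i - Tmap dplus w α b' i| ≤ α * c := by
  unfold Tmap
  rw [← sub_div, ← sum_sub_distrib]
  refine abs_sum_div_card_le (hd i) fun j _ => ?_
  rw [sub_sub_sub_cancel_left, abs_sub_comm]
  exact abs_Rmap_sub_Rmap_le hdm w hα h j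

end

theorem distance_to_fixed_point_bound
    {U O : Type} [Fintype U] [Nonempty U] [Fintype O] [Nonempty O] [DecidableEq O]
    (dplus : U → Finset O) (hd : ∀ i : U, (dplus i).Nonempty)
    (hdm : ∀ j : O, (dminus dplus j).Nonempty)
    (w : U → O → ℝ) (hw : ∀ i j, w i j ∈ Set.Icc (0 : ℝ) 1)
    (α : ℝ) (hα0 : 0 < α) (hα1 : α < 1)
    (b : ℕ → U → ℝ) (hb : ∀ t, b (t + 1) = Tmap dplus w α (b t))
    (hb0 : ∀ i : U, b 0 i ∈ Set.Icc (-1 : ℝ) 1)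
    (bstar : U → ℝ) (hfix : Tmap dplus w α bstar = bstar) :
    ∀ (t : ℕ) (i : U), |b t i - bstar i| ≤ 2 * α ^ t := by
  intro t
  induction t with
  | zero =>
    intro i
    have hstar := abs_Tmap_le_one hd hdm hw α bstar i
    rw [hfix, abs_le] at hstar
    rw [pow_zero, mul_one]
    exact abs_le.2 ⟨by linarith [(hb0 i).1, hstar.2], by linarith [(hb0 i).2, hstar.1]⟩
  | succ t ih =>
    intro i
    have hstep := abs_Tmap_sub_Tmap_le hd hdm w hα0.le ih i
    rw [hfix, ← hb] at hstep
    exact hstep.trans_eq (by ring)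
end

section
/- For any initial bias b⁰ : U → ℝ, the sequence of true-rating iterates converges: there exists r* : O → ℝ such that for every object j : O, the real sequence t ↦ r^{t+1}(j) = R(b^{t})(j) tends to r*(j) as t → ∞. -/
open Finset

theorem lipschitzWith_clamp : LipschitzWith 1 clamp :=
  (LipschitzWith.id.const_min 1).const_max 0

/-- The averages of two functions that are pointwise `c`-close are `c`-close. -/
theorem dist_sum_div_card_le {ι : Type*} {s : Finset ι} (hs : s.Nonempty) {f g : ι → ℝ} {c : ℝ}
    (h : ∀ i ∈ s, dist (f i) (g i) ≤ c) :
    dist ((∑ i ∈ s, f i) / s.card) ((∑ i ∈ s, g i) / s.card) ≤ c := by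
  have hpos : (0 : ℝ) < s.card := by exact_mod_cast hs.card_pos
  rw [Real.dist_eq, ← sub_div, abs_div, abs_of_pos hpos, div_le_iff₀ hpos, ← Real.dist_eq]
  calc dist (∑ i ∈ s, f i) (∑ i ∈ s, g i) ≤ ∑ _i ∈ s, c := dist_sum_sum_le_of_le s h
    _ = c * s.card := by rw [sum_const, nsmul_eq_mul, mul_comm]

theorem dist_Rmap_le {U O : Type} [Fintype U] [DecidableEq O] {dplus : U → Finset O}
    (w : U → O → ℝ) {α : ℝ} (hα : 0 ≤ α) {j : O} (hj : (dminus dplus j).Nonempty)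
    (b b' : U → ℝ) :
    dist (Rmap dplus w α b j) (Rmap dplus w α b' j) ≤ α * dist b b' := by
  refine dist_sum_div_card_le hj fun i _ => ?_
  calc dist (clamp (w i j - α * b i)) (clamp (w i j - α * b' i))
      ≤ dist (w i j - α * b i) (w i j - α * b' i) := by
        simpa only [NNReal.coe_one, one_mul] using lipschitzWith_clamp.dist_le_mul _ _
    _ = α * dist (b i) (b' i) := by
        rw [dist_sub_left, Real.dist_eq, Real.dist_eq, ← mul_sub, abs_mul, abs_of_nonneg hα]
    _ ≤ α * dist b b' := by gcongr; exact dist_le_pi_dist b b' i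

theorem dist_Tmap_le {U O : Type} [Fintype U] [DecidableEq O] {dplus : U → Finset O}
    (hd : ∀ i, (dplus i).Nonempty) (hdm : ∀ j, (dminus dplus j).Nonempty)
    (w : U → O → ℝ) {α : ℝ} (hα : 0 ≤ α) (b b' : U → ℝ) :
    dist (Tmap dplus w α b) (Tmap dplus w α b') ≤ α * dist b b' := by
  refine (dist_pi_le_iff (by positivity)).2 fun i => dist_sum_div_card_le (hd i) fun j _ => ?_
  rw [dist_sub_left]
  exact dist_Rmap_le w hα (hdm j) b b'

theorem rating_iterates_converge
    {U O : Type} [Fintype U] [Nonempty U] [Fintype O] [Nonempty O] [DecidableEq O]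
    (dplus : U → Finset O) (hd : ∀ i : U, (dplus i).Nonempty)
    (hdm : ∀ j : O, (dminus dplus j).Nonempty)
    (w : U → O → ℝ) (hw : ∀ i j, w i j ∈ Set.Icc (0 : ℝ) 1)
    (α : ℝ) (hα0 : 0 < α) (hα1 : α < 1)
    (b : ℕ → U → ℝ) (hb : ∀ t, b (t + 1) = Tmap dplus w α (b t)) :
    ∃ rstar : O → ℝ, ∀ j : O,
      Filter.Tendsto (fun t => Rmap dplus w α (b t) j) Filter.atTop (nhds (rstar j)) := by
  lift α to NNReal using hα0.le
  have hT : ContractingWith α (Tmap dplus w α) :=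
    ⟨by exact_mod_cast hα1, LipschitzWith.of_dist_le_mul (dist_Tmap_le hd hdm w hα0.le)⟩
  have hiter : b = fun t => (Tmap dplus w α)^[t] (b 0) := by
    funext t
    induction t with
    | zero => rfl
    | succ t ih => rw [hb, ih, Function.iterate_succ_apply']
  have hlim := hT.tendsto_iterate_fixedPoint (b 0)
  rw [← hiter] at hlim
  refine ⟨Rmap dplus w α hT.fixedPoint, fun j => ?_⟩
  have hR : LipschitzWith α fun x => Rmap dplus w α x j :=
    LipschitzWith.of_dist_le_mul (dist_Rmap_le w hα0.le (hdm j))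
  exact (hR.continuous.tendsto _).comp hlim
end
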